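/- Let C and D be r×r matrices over B all of whose entries lie in the k-span of {x, y, xy, yx} (equivalently, no entry is a unit), and suppose ν(C)D = wI_r and DC = wI_r. Let M be the image of the left A-linear map Aʳ → Aʳ given by right multiplication by the reduction of C modulo w. Then dim_k M = 2r and dim_k (x·M) = dim_k (y·M) = r; that is, x and y each act on M as k-linear maps of rank exactly r. -/

import Mathlib

noncomputable section
open FreeAlgebra Matrix

/-- The defining relations of `B = k⟨x,y⟩/(x², y², xyx, yxy)`. -/
inductive BRel (k : Type*) [Field k] : FreeAlgebra k (Fin 2) → FreeAlgebra k (Fin 2) → Prop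
  | xx : BRel k (ι k 0 * ι k 0) 0
  | yy : BRel k (ι k 1 * ι k 1) 0
  | xyx : BRel k (ι k 0 * ι k 1 * ι k 0) 0
  | yxy : BRel k (ι k 1 * ι k 0 * ι k 1) 0

/-- The algebra `B = k⟨x,y⟩/(x², y², xyx, yxy)`. -/
abbrev B (k : Type*) [Field k] := RingQuot (BRel k)

/-- The image of the generator `x` in `B`. -/
def Bx (k : Type*) [Field k] : B k := RingQuot.mkAlgHom k (BRel k) (ι k 0)

/-- The image of the generator `y` in `B`. -/
def By (k : Type*) [Field k] : B k := RingQuot.mkAlgHom k (BRel k) (ι k 1)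

/-- The element `w = xy - q·yx` of `B`. -/
def wB (k : Type*) [Field k] (q : k) : B k := Bx k * By k - q • (By k * Bx k)
set_option maxSynthPendingDepth 3

/-- The relation generating the two-sided ideal `(w)` of `B`. -/
inductive ARel (k : Type*) [Field k] (q : k) : B k → B k → Prop
  | w : ARel k q (wB k q) 0

/-- The quantum complete intersection `A = B/(w)`. -/
abbrev Aalg (k : Type*) [Field k] (q : k) := RingQuot (ARel k q)

/-- The quotient map `B → A = B/(w)`. -/
def piA (k : Type*) [Field k] (q : k) : B k →ₐ[k] Aalg k q :=
  RingQuot.mkAlgHom k (ARel k q)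

/-- The image of `x` in `A`. -/
def Ax (k : Type*) [Field k] (q : k) : Aalg k q := piA k q (Bx k)

/-- The image of `y` in `A`. -/
def Ay (k : Type*) [Field k] (q : k) : Aalg k q := piA k q (By k)

/-- Regard a matrix over `k` as a matrix over `B` via the structure map. -/
def matB (k : Type*) [Field k] {r : ℕ} (M : Matrix (Fin r) (Fin r) k) :
    Matrix (Fin r) (Fin r) (B k) :=
  M.map (algebraMap k (B k))

/-- The image (as a `k`-subspace of `Aʳ`) of right multiplication of row vectors by a
matrix `M` over `A`. -/
def imageM (k : Type*) [Field k] (q : k) {r : ℕ} (M : Matrix (Fin r) (Fin r) (Aalg k q)) :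
    Submodule k (Fin r → Aalg k q) :=
  Submodule.span k (Set.range fun u : Fin r → Aalg k q => u ᵥ* M)

section RelationsB

variable (k : Type*) [Field k]

lemma Bx_mul_Bx : Bx k * Bx k = 0 := by
  simpa [Bx] using RingQuot.mkAlgHom_rel k (BRel.xx (k := k))

lemma By_mul_By : By k * By k = 0 := by
  simpa [By] using RingQuot.mkAlgHom_rel k (BRel.yy (k := k))

lemma Bx_mul_By_mul_Bx : Bx k * By k * Bx k = 0 := by
  simpa [Bx, By] using RingQuot.mkAlgHom_rel k (BRel.xyx (k := k))

lemma By_mul_Bx_mul_By : By k * Bx k * By k = 0 := by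
  simpa [Bx, By] using RingQuot.mkAlgHom_rel k (BRel.yxy (k := k))

variable {k}

/-- Two elements satisfying the defining relations of `B` induce an algebra map out of `B`. -/
def liftB {R : Type*} [Ring R] [Algebra k R] (X Y : R) (hxx : X * X = 0) (hyy : Y * Y = 0)
    (hxyx : X * Y * X = 0) (hyxy : Y * X * Y = 0) : B k →ₐ[k] R :=
  RingQuot.liftAlgHom k ⟨FreeAlgebra.lift k ![X, Y], by
    rintro _ _ (_ | _ | _ | _) <;> simp [hxx, hyy, hxyx, hyxy]⟩

section

variable {R : Type*} [Ring R] [Algebra k R] {X Y : R} (hxx : X * X = 0) (hyy : Y * Y = 0)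
  (hxyx : X * Y * X = 0) (hyxy : Y * X * Y = 0)

@[simp]
lemma liftB_Bx : liftB (k := k) X Y hxx hyy hxyx hyxy (Bx k) = X := by
  simp [liftB, Bx]

@[simp]
lemma liftB_By : liftB (k := k) X Y hxx hyy hxyx hyxy (By k) = Y := by
  simp [liftB, By]

end

lemma eq_and_eq_of_smul_xy_add_smul_yx_eq {a b c d : k}
    (h : a • (Bx k * By k) + b • (By k * Bx k) = c • (Bx k * By k) + d • (By k * Bx k)) :
    a = c ∧ b = d := by
  let X : Matrix (Fin 3) (Fin 3) k := !![0, 1, 0; 0, 0, 0; 0, 0, 0]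
  let Y : Matrix (Fin 3) (Fin 3) k := !![0, 0, 0; 0, 0, 1; 0, 0, 0]
  have hXX : X * X = 0 := by ext i j; fin_cases i <;> fin_cases j <;> simp [X]
  have hYY : Y * Y = 0 := by ext i j; fin_cases i <;> fin_cases j <;> simp [Y]
  have hYX : Y * X = 0 := by ext i j; fin_cases i <;> fin_cases j <;> simp [X, Y]
  have hXYX : X * Y * X = 0 := by rw [mul_assoc, hYX, mul_zero]
  have hYXY : Y * X * Y = 0 := by rw [hYX, zero_mul]
  have hXY : (X * Y) 0 2 = 1 := by simp [X, Y, Matrix.mul_apply, Fin.sum_univ_three]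
  constructor
  · simpa [hYX, hXY] using congr_fun₂ (congr_arg (liftB X Y hXX hYY hXYX hYXY) h) 0 2
  · simpa [hYX, hXY] using congr_fun₂ (congr_arg (liftB Y X hYY hXX hYXY hXYX) h) 0 2

lemma exists_coeff_of_mem_span {b : B k}
    (hb : b ∈ Submodule.span k ({Bx k, By k, Bx k * By k, By k * Bx k} : Set (B k))) :
    ∃ c₁ c₂ c₃ c₄ : k,
      b = c₁ • Bx k + c₂ • By k + c₃ • (Bx k * By k) + c₄ • (By k * Bx k) := by
  simp only [Submodule.mem_span_insert, Submodule.mem_span_singleton] at hb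
  obtain ⟨c₁, _, ⟨c₂, _, ⟨c₃, _, ⟨c₄, rfl⟩, rfl⟩, rfl⟩, rfl⟩ := hb
  exact ⟨c₁, c₂, c₃, c₄, by simp only [add_assoc]⟩

lemma exists_coeff_matrix {r : ℕ} {C : Matrix (Fin r) (Fin r) (B k)}
    (hC : ∀ i j, C i j ∈
      Submodule.span k ({Bx k, By k, Bx k * By k, By k * Bx k} : Set (B k))) :
    ∃ C₁ C₂ C₃ C₄ : Matrix (Fin r) (Fin r) k, ∀ i j, C i j =
      C₁ i j • Bx k + C₂ i j • By k + C₃ i j • (Bx k * By k) + C₄ i j • (By k * Bx k) := by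
  choose C₁ C₂ C₃ C₄ h using fun i j => exists_coeff_of_mem_span (hC i j)
  exact ⟨C₁, C₂, C₃, C₄, h⟩

lemma rad_mul_rad (c₁ c₂ c₃ c₄ d₁ d₂ d₃ d₄ : k) :
    (c₁ • Bx k + c₂ • By k + c₃ • (Bx k * By k) + c₄ • (By k * Bx k)) *
      (d₁ • Bx k + d₂ • By k + d₃ • (Bx k * By k) + d₄ • (By k * Bx k)) =
    (c₁ * d₂) • (Bx k * By k) + (c₂ * d₁) • (By k * Bx k) := by
  have h1 := Bx_mul_Bx k
  have h2 := By_mul_By k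
  have h3 := Bx_mul_By_mul_Bx k
  have h4 := By_mul_Bx_mul_By k
  rw [mul_assoc] at h3 h4
  have h5 (z : B k) : Bx k * (Bx k * z) = 0 := by rw [← mul_assoc, h1, zero_mul]
  have h6 (z : B k) : By k * (By k * z) = 0 := by rw [← mul_assoc, h2, zero_mul]
  simp only [mul_add, add_mul, smul_mul_assoc, mul_smul_comm, mul_assoc, h1, h2, h3, h4, h5, h6,
    mul_zero, smul_zero, add_zero, zero_add, smul_smul]
  rw [mul_comm d₂, mul_comm d₁, add_comm]

/-- In degree two, a product of radical matrices over `B` only sees the linear parts. -/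
lemma linear_parts_of_mul_eq {r : ℕ} {C D : Matrix (Fin r) (Fin r) (B k)}
    {C₁ C₂ C₃ C₄ D₁ D₂ D₃ D₄ : Matrix (Fin r) (Fin r) k} {q : k}
    (hC : ∀ i j, C i j = C₁ i j • Bx k + C₂ i j • By k + C₃ i j • (Bx k * By k)
      + C₄ i j • (By k * Bx k))
    (hD : ∀ i j, D i j = D₁ i j • Bx k + D₂ i j • By k + D₃ i j • (Bx k * By k)
      + D₄ i j • (By k * Bx k))
    (h : C * D = wB k q • (1 : Matrix (Fin r) (Fin r) (B k))) :
    C₁ * D₂ = 1 ∧ C₂ * D₁ = -q • (1 : Matrix (Fin r) (Fin r) k) := by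
  have key (i j : Fin r) := eq_and_eq_of_smul_xy_add_smul_yx_eq (k := k)
    (a := (C₁ * D₂) i j) (b := (C₂ * D₁) i j) (c := (1 : Matrix (Fin r) (Fin r) k) i j)
    (d := (-q • (1 : Matrix (Fin r) (Fin r) k)) i j) <| by
      have hij := congr_fun₂ h i j
      simp only [Matrix.mul_apply, hC, hD, rad_mul_rad, Finset.sum_add_distrib,
        ← Finset.sum_smul] at hij
      simp only [Matrix.mul_apply]
      rw [hij]
      by_cases hne : i = j
      · subst hne
        simp [wB, sub_eq_add_neg]
      · simp [hne]
  exact ⟨by ext i j; exact (key i j).1, by ext i j; exact (key i j).2⟩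

end RelationsB

section RelationsA

variable {k : Type*} [Field k] {q : k}

lemma Ax_mul_Ax : Ax k q * Ax k q = 0 := by
  rw [Ax, ← map_mul, Bx_mul_Bx, map_zero]

lemma Ay_mul_Ay : Ay k q * Ay k q = 0 := by
  rw [Ay, ← map_mul, By_mul_By, map_zero]

lemma Ax_mul_Ay : Ax k q * Ay k q = q • (Ay k q * Ax k q) := by
  have h : piA k q (wB k q) = 0 := by
    simpa [piA] using RingQuot.mkAlgHom_rel k (ARel.w (k := k) (q := q))
  rwa [wB, map_sub, map_smul, map_mul, map_mul, sub_eq_zero] at h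

lemma Ax_mul_Ay_mul_Ax : Ax k q * (Ay k q * Ax k q) = 0 := by
  rw [Ax, Ay, ← map_mul, ← map_mul, ← mul_assoc, Bx_mul_By_mul_Bx, map_zero]

lemma Ay_mul_Ay_mul_Ax : Ay k q * (Ay k q * Ax k q) = 0 := by
  rw [← mul_assoc, Ay_mul_Ay, zero_mul]

lemma mul_rad (α β γ δ c₁ c₂ c₃ c₄ : k) :
    (α • (1 : Aalg k q) + β • Ax k q + γ • Ay k q + δ • (Ay k q * Ax k q)) *
      (c₁ • Ax k q + c₂ • Ay k q + c₃ • (Ax k q * Ay k q) + c₄ • (Ay k q * Ax k q)) =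
    (α * c₁) • Ax k q + (α * c₂) • Ay k q +
      (α * (q * c₃ + c₄) + q * (β * c₂) + γ * c₁) • (Ay k q * Ax k q) := by
  simp only [mul_add, add_mul, smul_mul_assoc, mul_smul_comm, mul_assoc, one_mul, Ax_mul_Ax,
    Ay_mul_Ay, Ax_mul_Ay_mul_Ax, Ay_mul_Ay_mul_Ax, Ax_mul_Ay, mul_zero,
    smul_zero, add_zero, smul_smul]
  module

lemma exists_coeff (a : Aalg k q) : ∃ α β γ δ : k,
    a = α • (1 : Aalg k q) + β • Ax k q + γ • Ay k q + δ • (Ay k q * Ax k q) := by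
  obtain ⟨b, rfl⟩ := RingQuot.mkAlgHom_surjective k (ARel k q) a
  obtain ⟨f, rfl⟩ := RingQuot.mkAlgHom_surjective k (BRel k) b
  change ∃ α β γ δ : k, piA k q _ = _
  induction f using FreeAlgebra.induction with
  | grade0 c => exact ⟨c, 0, 0, 0, by simp [Algebra.algebraMap_eq_smul_one]⟩
  | grade1 i =>
    fin_cases i
    · exact ⟨0, 1, 0, 0, by simp [Ax, Bx]⟩
    · exact ⟨0, 0, 1, 0, by simp [Ay, By]⟩
  | mul f g hf hg =>
    obtain ⟨α, β, γ, δ, hf⟩ := hf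
    obtain ⟨α', β', γ', δ', hg⟩ := hg
    refine ⟨α * α', α * β' + β * α', α * γ' + γ * α',
      α * δ' + q * (β * γ') + γ * β' + δ * α', ?_⟩
    have h := mul_rad (q := q) α β γ δ β' γ' 0 δ'
    rw [zero_smul, add_zero] at h
    rw [map_mul, map_mul, hf, hg, add_assoc (α' • _), add_assoc (α' • _), mul_add, h,
      mul_smul_comm, mul_one]
    module
  | add f g hf hg =>
    obtain ⟨α, β, γ, δ, hf⟩ := hf
    obtain ⟨α', β', γ', δ', hg⟩ := hg
    refine ⟨α + α', β + β', γ + γ', δ + δ', ?_⟩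
    rw [map_add, map_add, hf, hg]
    module

lemma coeff_eq_zero {a b c : k} (h : a • Ax k q + b • Ay k q + c • (Ay k q * Ax k q) = 0) :
    a = 0 ∧ b = 0 ∧ c = 0 := by
  let X : Matrix (Fin 4) (Fin 4) k := !![0, 0, 0, 0; 1, 0, 0, 0; 0, 0, 0, 0; 0, 0, q, 0]
  let Y : Matrix (Fin 4) (Fin 4) k := !![0, 0, 0, 0; 0, 0, 0, 0; 1, 0, 0, 0; 0, 1, 0, 0]
  have hXX : X * X = 0 := by
    ext i j; fin_cases i <;> fin_cases j <;> simp [X]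
  have hYY : Y * Y = 0 := by
    ext i j; fin_cases i <;> fin_cases j <;> simp [Y]
  have hXY : X * Y = q • (Y * X) := by
    ext i j; fin_cases i <;> fin_cases j <;> simp [X, Y]
  have hXYX : X * Y * X = 0 := by
    rw [hXY, smul_mul_assoc, mul_assoc, hXX, mul_zero, smul_zero]
  have hYXY : Y * X * Y = 0 := by
    rw [mul_assoc, hXY, mul_smul_comm, ← mul_assoc, hYY, zero_mul, smul_zero]
  let f : Aalg k q →ₐ[k] Matrix (Fin 4) (Fin 4) k :=
    RingQuot.liftAlgHom k ⟨liftB X Y hXX hYY hXYX hYXY, by rintro _ _ ⟨⟩; simp [wB, hXY]⟩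
  have hfx : f (Ax k q) = X := by simp [f, Ax, piA]
  have hfy : f (Ay k q) = Y := by simp [f, Ay, piA]
  have hf := congr_arg f h
  simp only [map_add, map_smul, map_mul, hfx, hfy, map_zero] at hf
  refine ⟨?_, ?_, ?_⟩
  · simpa [X, Y, Matrix.mul_apply, Fin.sum_univ_four] using congr_fun₂ hf 1 0
  · simpa [X, Y, Matrix.mul_apply, Fin.sum_univ_four] using congr_fun₂ hf 2 0
  · simpa [X, Y, Matrix.mul_apply, Fin.sum_univ_four] using congr_fun₂ hf 3 0

end RelationsA

section Image

variable {k : Type*} [Field k] (q : k) {r : ℕ}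

/-- The map `v ↦ v · yx` from `kʳ` to `Aʳ`. -/
def socleMap (r : ℕ) : (Fin r → k) →ₗ[k] (Fin r → Aalg k q) :=
  LinearMap.pi fun j => (LinearMap.proj j).smulRight (Ay k q * Ax k q)

/-- The map `(a, v) ↦ aC₁ · x + aC₂ · y + v · yx` from `kʳ × kʳ` to `Aʳ`. -/
def radMap (C₁ C₂ : Matrix (Fin r) (Fin r) k) :
    ((Fin r → k) × (Fin r → k)) →ₗ[k] (Fin r → Aalg k q) :=
  LinearMap.pi fun j =>
    ((LinearMap.proj j ∘ₗ C₁.vecMulLinear).smulRight (Ax k q) +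
      (LinearMap.proj j ∘ₗ C₂.vecMulLinear).smulRight (Ay k q)) ∘ₗ LinearMap.fst k _ _ +
    ((LinearMap.proj j).smulRight (Ay k q * Ax k q)) ∘ₗ LinearMap.snd k _ _

@[simp]
lemma socleMap_apply (v : Fin r → k) (j : Fin r) :
    socleMap q r v j = v j • (Ay k q * Ax k q) := rfl

@[simp]
lemma radMap_apply (C₁ C₂ : Matrix (Fin r) (Fin r) k) (p : (Fin r → k) × (Fin r → k))
    (j : Fin r) : radMap q C₁ C₂ p j =
      (p.1 ᵥ* C₁) j • Ax k q + (p.1 ᵥ* C₂) j • Ay k q + p.2 j • (Ay k q * Ax k q) := rfl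

lemma socleMap_injective : Function.Injective (socleMap q r) := by
  rw [injective_iff_map_eq_zero]
  intro v hv
  ext j
  exact (coeff_eq_zero (a := 0) (b := 0) (by simpa using congr_fun hv j)).2.2

lemma radMap_injective {C₁ C₂ E : Matrix (Fin r) (Fin r) k} (hE : C₁ * E = 1) :
    Function.Injective (radMap q C₁ C₂) := by
  rw [injective_iff_map_eq_zero]
  rintro ⟨a, v⟩ h
  have key (j : Fin r) := coeff_eq_zero (by simpa using congr_fun h j)
  have ha : a ᵥ* C₁ = 0 := funext fun j => (key j).1
  have ha' : a = 0 := by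
    rw [← Matrix.vecMul_one a, ← hE, ← Matrix.vecMul_vecMul, ha, Matrix.zero_vecMul]
  exact Prod.ext ha' (funext fun j => (key j).2.2)

variable {q} {C₁ C₂ C₃ C₄ : Matrix (Fin r) (Fin r) k}

lemma vecMul_eq_radMap {C : Matrix (Fin r) (Fin r) (Aalg k q)}
    (hC : ∀ i j, C i j = C₁ i j • Ax k q + C₂ i j • Ay k q + C₃ i j • (Ax k q * Ay k q)
      + C₄ i j • (Ay k q * Ax k q)) (α β γ δ : Fin r → k) :
    (fun i => α i • (1 : Aalg k q) + β i • Ax k q + γ i • Ay k q + δ i • (Ay k q * Ax k q)) ᵥ* C =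
      radMap q C₁ C₂ (α, α ᵥ* (q • C₃ + C₄) + q • (β ᵥ* C₂) + γ ᵥ* C₁) := by
  ext j
  simp only [Matrix.vecMul, dotProduct, hC, mul_rad, radMap_apply, Finset.sum_add_distrib,
    ← Finset.sum_smul, Pi.add_apply, Pi.smul_apply, Matrix.add_apply, Matrix.smul_apply,
    smul_eq_mul, Finset.mul_sum]

lemma imageM_eq_range {C : Matrix (Fin r) (Fin r) (Aalg k q)} {E : Matrix (Fin r) (Fin r) k}
    (hC : ∀ i j, C i j = C₁ i j • Ax k q + C₂ i j • Ay k q + C₃ i j • (Ax k q * Ay k q)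
      + C₄ i j • (Ay k q * Ax k q)) (hE : E * C₁ = 1) :
    imageM k q C = LinearMap.range (radMap q C₁ C₂) := by
  apply le_antisymm
  · rw [imageM, Submodule.span_le]
    rintro _ ⟨u, rfl⟩
    choose α β γ δ hu using fun i => exists_coeff (u i)
    rw [funext hu]
    exact ⟨_, (vecMul_eq_radMap hC α β γ δ).symm⟩
  · rintro _ ⟨⟨a, v⟩, rfl⟩
    have h := vecMul_eq_radMap hC a 0 ((v - a ᵥ* (q • C₃ + C₄)) ᵥ* E) 0
    rw [Matrix.zero_vecMul, smul_zero, add_zero, Matrix.vecMul_vecMul, hE, Matrix.vecMul_one,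
      add_sub_cancel] at h
    exact Submodule.subset_span ⟨_, h⟩

lemma Ax_smul_radMap (p : (Fin r → k) × (Fin r → k)) :
    Ax k q • radMap q C₁ C₂ p = socleMap q r (q • (p.1 ᵥ* C₂)) := by
  ext j
  simp [mul_add, Ax_mul_Ax, Ax_mul_Ay_mul_Ax, Ax_mul_Ay, smul_smul, mul_comm]

lemma Ay_smul_radMap (p : (Fin r → k) × (Fin r → k)) :
    Ay k q • radMap q C₁ C₂ p = socleMap q r (p.1 ᵥ* C₁) := by
  ext j
  simp [mul_add, Ay_mul_Ay, Ay_mul_Ay_mul_Ax]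

lemma finrank_span_eq_of_image_eq_socle {S : Set (Fin r → Aalg k q)}
    (hS : S = LinearMap.range (socleMap q r)) : Module.finrank k (Submodule.span k S) = r := by
  rw [hS, Submodule.span_eq, LinearMap.finrank_range_of_inj (socleMap_injective q),
    Module.finrank_fin_fun]

end Image

theorem stmt15 (k : Type*) [Field k] (q : k) (hq : q ≠ 0)
    (ν : B k ≃ₐ[k] B k)
    (hνx : ν (Bx k) = -(q⁻¹ • Bx k)) (hνy : ν (By k) = -(q • By k))
    (r : ℕ) (C D : Matrix (Fin r) (Fin r) (B k))
    (hCrad : ∀ i j, C i j ∈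
      Submodule.span k ({Bx k, By k, Bx k * By k, By k * Bx k} : Set (B k)))
    (hDrad : ∀ i j, D i j ∈
      Submodule.span k ({Bx k, By k, Bx k * By k, By k * Bx k} : Set (B k)))
    (hfact1 : C.map ⇑ν * D = wB k q • (1 : Matrix (Fin r) (Fin r) (B k)))
    (hfact2 : D * C = wB k q • (1 : Matrix (Fin r) (Fin r) (B k))) :
    Module.finrank k (imageM k q (C.map ⇑(piA k q))) = 2 * r ∧
    Module.finrank k (Submodule.span k
      ((fun m : Fin r → Aalg k q => Ax k q • m) ''
        (imageM k q (C.map ⇑(piA k q)) : Set (Fin r → Aalg k q)))) = r ∧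
    Module.finrank k (Submodule.span k
      ((fun m : Fin r → Aalg k q => Ay k q • m) ''
        (imageM k q (C.map ⇑(piA k q)) : Set (Fin r → Aalg k q)))) = r := by
  obtain ⟨C₁, C₂, C₃, C₄, hC⟩ := exists_coeff_matrix hCrad
  obtain ⟨D₁, D₂, D₃, D₄, hD⟩ := exists_coeff_matrix hDrad
  obtain ⟨hDC₂, hDC₁⟩ := linear_parts_of_mul_eq hD hC hfact2
  have hE : (-q⁻¹ • D₂) * C₁ = 1 := by
    rw [Matrix.smul_mul, hDC₁, smul_smul, neg_mul_neg, inv_mul_cancel₀ hq, one_smul]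
  have hCA (i j : Fin r) : C.map (piA k q) i j = C₁ i j • Ax k q + C₂ i j • Ay k q
      + C₃ i j • (Ax k q * Ay k q) + C₄ i j • (Ay k q * Ax k q) := by
    simp only [Matrix.map_apply, hC, map_add, map_smul, map_mul, Ax, Ay]
  rw [imageM_eq_range hCA hE]
  refine ⟨?_, finrank_span_eq_of_image_eq_socle ?_, finrank_span_eq_of_image_eq_socle ?_⟩
  · rw [LinearMap.finrank_range_of_inj (radMap_injective q (mul_eq_one_comm.mp hE)),
      Module.finrank_prod, Module.finrank_fin_fun, two_mul]
  · ext m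
    constructor
    · rintro ⟨_, ⟨p, rfl⟩, rfl⟩
      exact ⟨_, (Ax_smul_radMap p).symm⟩
    · rintro ⟨v, rfl⟩
      refine ⟨_, ⟨((q⁻¹ • v) ᵥ* D₁, 0), rfl⟩, ?_⟩
      simp only [Ax_smul_radMap, Matrix.vecMul_vecMul, hDC₂, Matrix.vecMul_one, smul_smul,
        mul_inv_cancel₀ hq, one_smul]
  · ext m
    constructor
    · rintro ⟨_, ⟨p, rfl⟩, rfl⟩
      exact ⟨_, (Ay_smul_radMap p).symm⟩
    · rintro ⟨v, rfl⟩
      refine ⟨_, ⟨(v ᵥ* (-q⁻¹ • D₂), 0), rfl⟩, ?_⟩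
      simp only [Ay_smul_radMap, Matrix.vecMul_vecMul, hE, Matrix.vecMul_one]
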